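/- Monotonicity of M^R_{α,z} in z: for a density matrix ρ and parameters z₁ ≤ z₂ with 0 < max{α, 1-α} ≤ z₁ ≤ z₂ < 1, one has f_{α,z₁}(ρ, ρ*) ≥ f_{α,z₂}(ρ, ρ*), hence M^R_{α,z₁}(ρ) ≤ M^R_{α,z₂}(ρ). -/

import Mathlib

open Matrix ComplexOrder Kronecker

/-- Real power of a matrix via functional calculus (eigendecomposition) on
Hermitian matrices; junk value `0` otherwise. -/
noncomputable def mrpow {n : Type*} [Fintype n] [DecidableEq n]
    (A : Matrix n n ℂ) (r : ℝ) : Matrix n n ℂ :=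
  if h : A.IsHermitian then
    (h.eigenvectorUnitary : Matrix n n ℂ) *
      Matrix.diagonal ((fun i => (((h.eigenvalues i : ℝ) ^ r : ℝ) : ℂ)) : n → ℂ) *
      star (h.eigenvectorUnitary : Matrix n n ℂ)
  else 0

/-- Entrywise complex conjugate of a matrix. -/
def conjM {n : Type*} [Fintype n] [DecidableEq n] (A : Matrix n n ℂ) : Matrix n n ℂ :=
  A.map (starRingEnd ℂ)

/-- The quantity `f_{α,z}(ρ,σ) = Tr[(σ^{(1-α)/(2z)} ρ^{α/z} σ^{(1-α)/(2z)})^z]`. -/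
noncomputable def fRenyi {n : Type*} [Fintype n] [DecidableEq n]
    (α z : ℝ) (ρ σ : Matrix n n ℂ) : ℂ :=
  (mrpow (mrpow σ ((1 - α) / (2 * z)) * mrpow ρ (α / z) * mrpow σ ((1 - α) / (2 * z))) z).trace

/-- The weighted matrix geometric mean `A ♯_λ B = A^{1/2} (A^{-1/2} B A^{-1/2})^λ A^{1/2}`. -/
noncomputable def geomMean {n : Type*} [Fintype n] [DecidableEq n]
    (A B : Matrix n n ℂ) (l : ℝ) : Matrix n n ℂ :=
  mrpow A (1/2) * mrpow (mrpow A (-(1/2)) * B * mrpow A (-(1/2))) l * mrpow A (1/2)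

open scoped Matrix.Norms.L2Operator

/-- The complex power `x ^ w` of a nonnegative real `x`, with the convention `0 ^ w = 0` for every
`w`, which makes it entire in `w`. -/
noncomputable def entirePow (x : ℝ) (w : ℂ) : ℂ :=
  if x = 0 then 0 else Complex.exp (w * Real.log x)

@[fun_prop]
lemma differentiable_entirePow (x : ℝ) : Differentiable ℂ (entirePow x) := by
  unfold entirePow
  split_ifs <;> fun_prop

lemma entirePow_add (x : ℝ) (v w : ℂ) :
    entirePow x (v + w) = entirePow x v * entirePow x w := by
  unfold entirePow
  split_ifs
  · simp
  · rw [add_mul, Complex.exp_add]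

lemma norm_entirePow_of_pos {x : ℝ} (hx : 0 < x) (w : ℂ) : ‖entirePow x w‖ = x ^ w.re := by
  rw [entirePow, if_neg hx.ne', Complex.norm_exp, Real.rpow_def_of_pos hx]
  simp [mul_comm]

lemma norm_entirePow_le {x : ℝ} (hx : 0 ≤ x) (w : ℂ) : ‖entirePow x w‖ ≤ x ^ w.re := by
  rcases hx.eq_or_lt with rfl | hx
  · simpa [entirePow] using Real.rpow_nonneg le_rfl _
  · exact (norm_entirePow_of_pos hx w).le

lemma norm_entirePow_le_one_of_re_eq_zero {x : ℝ} (hx : 0 ≤ x) {w : ℂ} (hw : w.re = 0) :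
    ‖entirePow x w‖ ≤ 1 := by
  simpa [hw] using norm_entirePow_le hx w

lemma norm_entirePow_le_of_abs_re_le {K : ℝ} (x : ℝ) {w : ℂ} (hw : |w.re| ≤ K) :
    ‖entirePow x w‖ ≤ Real.exp (K * |Real.log x|) := by
  unfold entirePow
  split_ifs
  · simpa using (Real.exp_pos _).le
  · rw [Complex.norm_exp, Real.exp_le_exp]
    have : (w * (Real.log x : ℂ)).re = w.re * Real.log x := by simp
    rw [this]
    calc w.re * Real.log x ≤ |w.re| * |Real.log x| := by
          rw [← abs_mul]; exact le_abs_self _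
      _ ≤ K * |Real.log x| := by gcongr

lemma entirePow_ofReal {x : ℝ} (hx : 0 ≤ x) {r : ℝ} (hr : r ≠ 0) :
    entirePow x r = ((x ^ r : ℝ) : ℂ) := by
  rcases hx.eq_or_lt with rfl | hx
  · simp [entirePow, Real.zero_rpow hr]
  · rw [entirePow, if_neg hx.ne', Real.rpow_def_of_pos hx]
    push_cast
    rw [mul_comm]

section Contraction

variable {n : Type*} [Fintype n] [DecidableEq n]

lemma norm_le_one_of_mem_unitaryGroup {U : Matrix n n ℂ} (hU : U ∈ unitaryGroup n ℂ) :
    ‖U‖ ≤ 1 := by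
  have h : ‖Uᴴ * U‖ = ‖U‖ * ‖U‖ := l2_opNorm_conjTranspose_mul_self U
  rw [← star_eq_conjTranspose, mem_unitaryGroup_iff'.1 hU, ← diagonal_one,
    l2_opNorm_diagonal] at h
  have h1 : ‖(fun _ : n => (1 : ℂ))‖ ≤ 1 := (pi_norm_le_iff_of_nonneg zero_le_one).2 (by simp)
  nlinarith [norm_nonneg U]

lemma norm_diagonal_le_one {v : n → ℂ} (hv : ∀ i, ‖v i‖ ≤ 1) :
    ‖(diagonal v : Matrix n n ℂ)‖ ≤ 1 := by
  rw [l2_opNorm_diagonal]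
  exact (pi_norm_le_iff_of_nonneg zero_le_one).2 hv

lemma norm_mul_le_one {A B : Matrix n n ℂ} (hA : ‖A‖ ≤ 1) (hB : ‖B‖ ≤ 1) : ‖A * B‖ ≤ 1 :=
  (norm_mul_le A B).trans (mul_le_one₀ hA (norm_nonneg B) hB)

lemma sum_norm_sq_col_le (A : Matrix n n ℂ) (j : n) : ∑ i, ‖A i j‖ ^ 2 ≤ ‖A‖ ^ 2 := by
  have h := A.l2_opNorm_mulVec (EuclideanSpace.single j 1)
  rw [PiLp.norm_single, norm_one, mul_one] at h
  have h2 := pow_le_pow_left₀ (norm_nonneg _) h 2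
  rw [EuclideanSpace.norm_sq_eq] at h2
  simpa using h2

lemma sum_norm_sq_row_le (A : Matrix n n ℂ) (i : n) : ∑ j, ‖A i j‖ ^ 2 ≤ ‖A‖ ^ 2 := by
  simpa [l2_opNorm_conjTranspose] using sum_norm_sq_col_le Aᴴ i

lemma norm_apply_le_norm (A : Matrix n n ℂ) (i j : n) : ‖A i j‖ ≤ ‖A‖ := by
  have h := (Finset.single_le_sum (f := fun k => ‖A k j‖ ^ 2) (fun k _ => by positivity)
    (Finset.mem_univ i)).trans (sum_norm_sq_col_le A j)
  exact (pow_le_pow_iff_left₀ (norm_nonneg _) (norm_nonneg _) two_ne_zero).1 h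

/-- A matrix with orthogonal rows is a diagonal matrix of row norms times a partial isometry. -/
lemma exists_eq_diagonal_sqrt_mul {N : Matrix n n ℂ} {l : n → ℝ} (hl : ∀ i, 0 ≤ l i)
    (hN : N * Nᴴ = diagonal (fun i => (l i : ℂ))) :
    ∃ M : Matrix n n ℂ, N = diagonal (fun i => ((√(l i) : ℝ) : ℂ)) * M ∧ ‖M‖ ≤ 1 ∧
      ∀ i, (N * Mᴴ) i i = ((√(l i) : ℝ) : ℂ) := by
  have hrow : ∀ i, l i = 0 → ∀ j, N i j = 0 := by
    intro i hi j
    have h := congrFun (congrFun hN i) i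
    rw [diagonal_apply_eq, hi, mul_apply] at h
    simp only [conjTranspose_apply, RCLike.star_def, Complex.mul_conj'] at h
    have h' : ∑ k, ‖N i k‖ ^ 2 = 0 := by exact_mod_cast h
    have := (Finset.sum_eq_zero_iff_of_nonneg (fun k _ => by positivity)).1 h' j (Finset.mem_univ j)
    simpa using this
  have hsq : ∀ i, ((√(l i) : ℝ) : ℂ) * ((√(l i) : ℝ) : ℂ) = l i := fun i => by
    rw [← Complex.ofReal_mul, Real.mul_self_sqrt (hl i)]
  set D : Matrix n n ℂ := diagonal (fun i => (((√(l i))⁻¹ : ℝ) : ℂ)) with hD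
  have hDH : Dᴴ = D := by
    rw [hD, diagonal_conjTranspose]
    congr 1
    ext i
    simp
  have hNM : N * (D * N)ᴴ = diagonal (fun i => ((√(l i) : ℝ) : ℂ)) := by
    rw [conjTranspose_mul, hDH, ← mul_assoc, hN, hD, diagonal_mul_diagonal]
    congr 1
    ext i
    rw [← Complex.ofReal_mul, ← div_eq_mul_inv, Real.div_sqrt]
  refine ⟨D * N, ?_, ?_, fun i => by rw [hNM, diagonal_apply_eq]⟩
  · ext i j
    rw [hD, diagonal_mul, diagonal_mul]
    rcases eq_or_ne (l i) 0 with h | h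
    · simp [h, hrow i h j]
    · have : √(l i) ≠ 0 := (Real.sqrt_ne_zero (hl i)).2 h
      push_cast
      field_simp
  · have h : ‖((D * N)ᴴ)ᴴ * (D * N)ᴴ‖ = ‖(D * N)ᴴ‖ * ‖(D * N)ᴴ‖ :=
      l2_opNorm_conjTranspose_mul_self _
    rw [conjTranspose_conjTranspose, mul_assoc, hNM, l2_opNorm_conjTranspose, hD,
      diagonal_mul_diagonal] at h
    have h1 : ‖(diagonal fun i => (((√(l i))⁻¹ : ℝ) : ℂ) * ((√(l i) : ℝ) : ℂ) :
        Matrix n n ℂ)‖ ≤ 1 := by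
      refine norm_diagonal_le_one fun i => ?_
      rw [← Complex.ofReal_mul, Complex.norm_real]
      rcases eq_or_ne (√(l i)) 0 with h | h
      · simp [h]
      · simp [inv_mul_cancel₀ h]
    nlinarith [norm_nonneg (D * N)]

end Contraction

section ArakiLiebThirring

variable {n : Type*} [Fintype n] [DecidableEq n]

/-- The entire family `w ↦ diag(c)^w * W * diag(d)^w`. -/
noncomputable def powSandwich (c d : n → ℝ) (W : Matrix n n ℂ) (w : ℂ) : Matrix n n ℂ :=
  diagonal (fun i => entirePow (c i) w) * W * diagonal (fun i => entirePow (d i) w)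

lemma powSandwich_add (c d : n → ℝ) (W : Matrix n n ℂ) (v w : ℂ) :
    powSandwich c d W (v + w) =
      diagonal (fun i => entirePow (c i) v) * powSandwich c d W w *
        diagonal (fun i => entirePow (d i) v) := by
  ext i j
  simp only [powSandwich, diagonal_mul, mul_diagonal, entirePow_add]
  ring

lemma differentiable_powSandwich_apply (c d : n → ℝ) (W : Matrix n n ℂ) (i j : n) :
    Differentiable ℂ (fun w => powSandwich c d W w i j) := by
  simp only [powSandwich, diagonal_mul, mul_diagonal]
  fun_prop

lemma differentiable_mul_powSandwich_mul_apply (c d : n → ℝ) (W A B : Matrix n n ℂ) (i j : n) :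
    Differentiable ℂ (fun w => (A * powSandwich c d W w * B) i j) := by
  simp only [mul_apply]
  exact Differentiable.fun_sum fun a _ => (Differentiable.fun_sum fun b _ =>
    (differentiable_powSandwich_apply c d W b a).const_mul _).mul_const _

lemma norm_powSandwich_le_one {c d : n → ℝ} (hc : ∀ i, 0 ≤ c i) (hd : ∀ i, 0 ≤ d i)
    {W : Matrix n n ℂ} (hW : ‖W‖ ≤ 1) {w : ℂ} (hw : w.re = 0) : ‖powSandwich c d W w‖ ≤ 1 :=
  norm_mul_le_one (norm_mul_le_one
    (norm_diagonal_le_one fun i => norm_entirePow_le_one_of_re_eq_zero (hc i) hw) hW)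
    (norm_diagonal_le_one fun i => norm_entirePow_le_one_of_re_eq_zero (hd i) hw)

lemma exists_norm_powSandwich_apply_le (c d : n → ℝ) (W : Matrix n n ℂ) (i j : n) :
    ∃ K, ∀ w : ℂ, |w.re| ≤ 1 → ‖powSandwich c d W w i j‖ ≤ K := by
  refine ⟨Real.exp (1 * |Real.log (c i)|) * ‖W i j‖ * Real.exp (1 * |Real.log (d j)|),
    fun w hw => ?_⟩
  simp only [powSandwich, diagonal_mul, mul_diagonal, norm_mul]
  gcongr <;> exact norm_entirePow_le_of_abs_re_le _ hw

lemma exists_norm_mul_powSandwich_mul_apply_le (c d : n → ℝ) (W A B : Matrix n n ℂ) (i j : n) :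
    ∃ K, ∀ w : ℂ, |w.re| ≤ 1 → ‖(A * powSandwich c d W w * B) i j‖ ≤ K := by
  choose K hK using exists_norm_powSandwich_apply_le c d W
  refine ⟨∑ a, (∑ b, ‖A i b‖ * K b a) * ‖B a j‖, fun w hw => ?_⟩
  rw [mul_apply]
  refine (norm_sum_le _ _).trans (Finset.sum_le_sum fun a _ => ?_)
  rw [norm_mul, mul_apply]
  refine mul_le_mul_of_nonneg_right ?_ (norm_nonneg _)
  refine (norm_sum_le _ _).trans (Finset.sum_le_sum fun b _ => ?_)
  rw [norm_mul]
  exact mul_le_mul_of_nonneg_left (hK b a w hw) (norm_nonneg _)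

lemma young_mul_le {a l p t : ℝ} (ha : 0 ≤ a) (hl : 0 ≤ l) (hp : 1 ≤ p) (ht : 0 < t)
    {b : ℝ} (hb : b ≤ l ^ ((p - 1) * t)) :
    b * a ≤ a ^ p / p + (1 - 1 / p) * l ^ (p * t) := by
  rcases hp.eq_or_lt with rfl | hp
  · have : b ≤ 1 := by simpa using hb
    have := mul_le_mul_of_nonneg_right this ha
    simpa using this
  · have hq := Real.HolderConjugate.conjExponent hp
    have h := Real.young_inequality_of_nonneg ha (Real.rpow_nonneg hl ((p - 1) * t)) hq
    rw [← Real.rpow_mul hl] at h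
    have e : (p - 1) * t * p.conjExponent = p * t := by
      have : p - 1 ≠ 0 := by linarith
      rw [Real.conjExponent]
      field_simp
    have e2 : 1 - 1 / p = 1 / p.conjExponent := by
      have : p - 1 ≠ 0 := by linarith
      have : p ≠ 0 := by linarith
      rw [Real.conjExponent]
      field_simp
    rw [e] at h
    rw [e2]
    calc b * a ≤ a * l ^ ((p - 1) * t) := by
          rw [mul_comm]; exact mul_le_mul_of_nonneg_left hb ha
      _ ≤ _ := h
      _ = _ := by ring

/-- A Young-type bound for a bilinear pairing of two contractions. -/
lemma norm_sum_mul_le_of_contraction {P Q : Matrix n n ℂ} (hP : ‖P‖ ≤ 1) (hQ : ‖Q‖ ≤ 1)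
    {k : n → ℂ} {a u v : n → ℝ} (ha : ∀ i, 0 ≤ a i) (hu : ∀ i, 0 ≤ u i) (hv : ∀ j, 0 ≤ v j)
    (h : ∀ j i, ‖k j‖ * a i ≤ u i + v j) :
    ‖∑ j, k j * ∑ i, P j i * (a i : ℂ) * Q i j‖ ≤ ∑ i, u i + ∑ j, v j := by
  have hsq : ∀ {A : Matrix n n ℂ}, ‖A‖ ≤ 1 → ‖A‖ ^ 2 ≤ 1 := fun hA =>
    pow_le_one₀ (norm_nonneg _) hA
  have hPr : ∀ j, ∑ i, ‖P j i‖ ^ 2 ≤ 1 := fun j => (sum_norm_sq_row_le P j).trans (hsq hP)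
  have hPc : ∀ i, ∑ j, ‖P j i‖ ^ 2 ≤ 1 := fun i => (sum_norm_sq_col_le P i).trans (hsq hP)
  have hQr : ∀ i, ∑ j, ‖Q i j‖ ^ 2 ≤ 1 := fun i => (sum_norm_sq_row_le Q i).trans (hsq hQ)
  have hQc : ∀ j, ∑ i, ‖Q i j‖ ^ 2 ≤ 1 := fun j => (sum_norm_sq_col_le Q j).trans (hsq hQ)
  set m : n → n → ℝ := fun j i => (‖P j i‖ ^ 2 + ‖Q i j‖ ^ 2) / 2 with hm
  have hm0 : ∀ j i, 0 ≤ m j i := fun j i => by positivity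
  have hmr : ∀ j, ∑ i, m j i ≤ 1 := fun j => by
    simp only [hm, ← Finset.sum_div, Finset.sum_add_distrib]
    linarith [hPr j, hQc j]
  have hmc : ∀ i, ∑ j, m j i ≤ 1 := fun i => by
    simp only [hm, ← Finset.sum_div, Finset.sum_add_distrib]
    linarith [hPc i, hQr i]
  calc ‖∑ j, k j * ∑ i, P j i * (a i : ℂ) * Q i j‖
      ≤ ∑ j, ∑ i, (u i + v j) * m j i := by
        refine (norm_sum_le _ _).trans (Finset.sum_le_sum fun j _ => ?_)
        rw [Finset.mul_sum]
        refine (norm_sum_le _ _).trans (Finset.sum_le_sum fun i _ => ?_)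
        rw [norm_mul, norm_mul, norm_mul, Complex.norm_real, Real.norm_of_nonneg (ha i)]
        calc ‖k j‖ * (‖P j i‖ * a i * ‖Q i j‖) = ‖k j‖ * a i * (‖P j i‖ * ‖Q i j‖) := by ring
          _ ≤ (u i + v j) * m j i := by
            gcongr
            · exact add_nonneg (hu i) (hv j)
            · exact h j i
            · simp only [hm]
              nlinarith [sq_nonneg (‖P j i‖ - ‖Q i j‖)]
    _ = ∑ i, u i * ∑ j, m j i + ∑ j, v j * ∑ i, m j i := by
        simp only [add_mul, Finset.sum_add_distrib, Finset.mul_sum]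
        rw [Finset.sum_comm]
    _ ≤ ∑ i, u i + ∑ j, v j := by
        gcongr with i _ j _
        · exact mul_le_of_le_one_right (hu i) (hmc i)
        · exact mul_le_of_le_one_right (hv j) (hmr j)

lemma conjTranspose_mul_mul_conjTranspose_eq_diagonal {E F D : Matrix n n ℂ}
    (hE : E ∈ unitaryGroup n ℂ) (h : F * Fᴴ = E * D * Eᴴ) :
    (Eᴴ * F) * (Eᴴ * F)ᴴ = D := by
  have hE' : Eᴴ * E = 1 := mem_unitaryGroup_iff'.1 hE
  calc (Eᴴ * F) * (Eᴴ * F)ᴴ = Eᴴ * (F * Fᴴ) * E := by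
        simp only [conjTranspose_mul, conjTranspose_conjTranspose, mul_assoc]
    _ = (Eᴴ * E) * D * (Eᴴ * E) := by rw [h]; simp only [mul_assoc]
    _ = D := by rw [hE', one_mul, mul_one]

/-- **Araki–Lieb–Thirring inequality** for Schatten exponents `p ≥ 1`, in terms of the eigenvalues
`l` of `F(s) F(s)ᴴ` and `m` of `F(1) F(1)ᴴ`, where `F(w) = diag(c)^w * W * diag(d)^w`. -/
theorem sum_rpow_le_of_powSandwich {c d : n → ℝ} (hc : ∀ i, 0 ≤ c i) (hd : ∀ i, 0 ≤ d i)
    {W E X : Matrix n n ℂ} (hW : ‖W‖ ≤ 1) (hE : E ∈ unitaryGroup n ℂ)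
    (hX : X ∈ unitaryGroup n ℂ) {l m : n → ℝ} (hl : ∀ i, 0 ≤ l i) (hm : ∀ i, 0 ≤ m i)
    {s p : ℝ} (hs0 : 0 < s) (hs1 : s ≤ 1) (hp : 1 ≤ p)
    (hlE : powSandwich c d W s * (powSandwich c d W s)ᴴ =
      E * diagonal (fun i => (l i : ℂ)) * Eᴴ)
    (hmX : powSandwich c d W 1 * (powSandwich c d W 1)ᴴ =
      X * diagonal (fun i => (m i : ℂ)) * Xᴴ) :
    ∑ i, l i ^ (p / (2 * s)) ≤ ∑ i, m i ^ (p / 2) := by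
  have hps : 0 < p / (2 * s) := by positivity
  obtain ⟨M, hM, hM1, hMd⟩ := exists_eq_diagonal_sqrt_mul hl
    (conjTranspose_mul_mul_conjTranspose_eq_diagonal hE hlE)
  obtain ⟨Z, hZ, hZ1, -⟩ := exists_eq_diagonal_sqrt_mul hm
    (conjTranspose_mul_mul_conjTranspose_eq_diagonal hX hmX)
  have hEn : ‖Eᴴ‖ ≤ 1 := by
    rw [l2_opNorm_conjTranspose]; exact norm_le_one_of_mem_unitaryGroup hE
  have hXn : ‖X‖ ≤ 1 := norm_le_one_of_mem_unitaryGroup hX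
  have hMn : ‖Mᴴ‖ ≤ 1 := by rwa [l2_opNorm_conjTranspose]
  set S := ∑ i, l i ^ (p / (2 * s)) with hS
  set T := ∑ i, m i ^ (p / 2) with hT
  have hS0 : 0 ≤ S := Finset.sum_nonneg fun i _ => Real.rpow_nonneg (hl i) _
  have hT0 : 0 ≤ T := Finset.sum_nonneg fun i _ => Real.rpow_nonneg (hm i) _
  rcases hS0.eq_or_lt with h | hSpos
  · rw [← h]; exact hT0
  let g : ℂ → ℂ := fun w =>
    ∑ j, entirePow (l j) ((p - w) / (2 * s)) * (Eᴴ * powSandwich c d W w * Mᴴ) j j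
  have hre : ∀ w : ℂ, (((p : ℂ) - w) / (2 * s)).re = (p - w.re) / (2 * s) := fun w => by
    have : ((p : ℂ) - w) / (2 * s) = (p - w) / ((2 * s : ℝ) : ℂ) := by push_cast; rfl
    rw [this, Complex.div_ofReal_re]
    simp
  have hgs : g s = S := by
    simp only [g, hS]
    push_cast
    refine Finset.sum_congr rfl fun j _ => ?_
    rw [hMd j]
    have e : ((p : ℂ) - s) / (2 * s) = (((p - s) / (2 * s) : ℝ) : ℂ) := by push_cast; rfl
    rw [e]
    rcases (hl j).eq_or_lt with h0 | h0
    · rw [← h0, Real.zero_rpow hps.ne']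
      simp
    · rw [entirePow, if_neg h0.ne', Real.sqrt_eq_rpow, Real.rpow_def_of_pos h0,
        Real.rpow_def_of_pos h0]
      push_cast
      rw [← Complex.exp_add]
      congr 1
      have : (s : ℂ) ≠ 0 := by exact_mod_cast hs0.ne'
      field_simp
      ring
  have hgd : Differentiable ℂ g := by
    refine Differentiable.fun_sum fun j _ => Differentiable.mul ?_
      (differentiable_mul_powSandwich_mul_apply c d W _ _ j j)
    exact (differentiable_entirePow (l j)).comp
      (((differentiable_const _).sub differentiable_id).div_const _)
  have hgb : BddAbove ((norm ∘ g) '' Complex.HadamardThreeLines.verticalClosedStrip 0 1) := by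
    choose K hK using fun j => exists_norm_mul_powSandwich_mul_apply_le c d W Eᴴ Mᴴ j j
    refine ⟨∑ j, Real.exp (p / (2 * s) * |Real.log (l j)|) * K j, ?_⟩
    rintro _ ⟨w, hw, rfl⟩
    have hw' : 0 ≤ w.re ∧ w.re ≤ 1 := hw
    refine (norm_sum_le _ _).trans (Finset.sum_le_sum fun j _ => ?_)
    rw [norm_mul]
    refine mul_le_mul (norm_entirePow_le_of_abs_re_le _ ?_)
      (hK j w (abs_le.2 ⟨by linarith, hw'.2⟩)) (norm_nonneg _) (Real.exp_pos _).le
    rw [hre, abs_of_nonneg (div_nonneg (by linarith) (by linarith))]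
    exact div_le_div_of_nonneg_right (by linarith) (by linarith)
  have hg0 : ∀ w ∈ Complex.re ⁻¹' {0}, ‖g w‖ ≤ S := by
    intro w hw
    have hw : w.re = 0 := hw
    refine (norm_sum_le _ _).trans (Finset.sum_le_sum fun j _ => ?_)
    rw [norm_mul]
    have h1 := norm_entirePow_le (hl j) ((p - w) / (2 * s))
    rw [hre, hw, sub_zero] at h1
    have h2 : ‖(Eᴴ * powSandwich c d W w * Mᴴ) j j‖ ≤ 1 := (norm_apply_le_norm _ j j).trans
      (norm_mul_le_one (norm_mul_le_one hEn (norm_powSandwich_le_one hc hd hW hw)) hMn)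
    exact (mul_le_of_le_one_right (norm_nonneg _) h2).trans h1
  have hg1 : ∀ w ∈ Complex.re ⁻¹' {1}, ‖g w‖ ≤ T / p + (1 - 1 / p) * S := by
    intro w hw
    have hw : w.re = 1 := hw
    have hw0 : (w - 1).re = 0 := by simp [hw]
    have hF1 : powSandwich c d W 1 =
        X * (diagonal (fun i => ((√(m i) : ℝ) : ℂ)) * Z) := by
      rw [← hZ, ← mul_assoc, ← star_eq_conjTranspose, mem_unitaryGroup_iff.1 hX, one_mul]
    have hFw : Eᴴ * powSandwich c d W w * Mᴴ =
        (Eᴴ * diagonal (fun i => entirePow (c i) (w - 1)) * X) *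
          diagonal (fun i => ((√(m i) : ℝ) : ℂ)) *
          (Z * diagonal (fun i => entirePow (d i) (w - 1)) * Mᴴ) := by
      conv_lhs => rw [← sub_add_cancel w 1, powSandwich_add, hF1]
      simp only [mul_assoc]
    have hP := norm_mul_le_one (norm_mul_le_one hEn
      (norm_diagonal_le_one fun i => norm_entirePow_le_one_of_re_eq_zero (hc i) hw0)) hXn
    have hQ := norm_mul_le_one (norm_mul_le_one hZ1
      (norm_diagonal_le_one fun i => norm_entirePow_le_one_of_re_eq_zero (hd i) hw0)) hMn
    have h1p : 0 ≤ 1 - 1 / p := by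
      rw [sub_nonneg, div_le_one (by linarith)]; exact hp
    have key := norm_sum_mul_le_of_contraction hP hQ
      (k := fun j => entirePow (l j) ((p - w) / (2 * s))) (a := fun i => √(m i))
      (u := fun i => m i ^ (p / 2) / p) (v := fun j => (1 - 1 / p) * l j ^ (p / (2 * s)))
      (fun i => Real.sqrt_nonneg _)
      (fun i => div_nonneg (Real.rpow_nonneg (hm i) _) (by linarith))
      (fun j => mul_nonneg h1p (Real.rpow_nonneg (hl j) _)) (fun j i => by
        have hb := norm_entirePow_le (hl j) ((p - w) / (2 * s))
        rw [hre, hw, div_eq_mul_inv] at hb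
        have h := young_mul_le (Real.sqrt_nonneg (m i)) (hl j) hp
          (inv_pos.2 (by linarith : 0 < 2 * s)) hb
        rwa [Real.sqrt_eq_rpow, ← Real.rpow_mul (hm i), one_div_mul_eq_div,
          ← Real.sqrt_eq_rpow, ← div_eq_mul_inv] at h)
    rw [← Finset.sum_div, ← Finset.mul_sum] at key
    refine le_trans (le_of_eq ?_) key
    simp only [g]
    congr 1
    refine Finset.sum_congr rfl fun j _ => ?_
    rw [hFw, mul_apply]
    simp only [mul_diagonal (d := fun i => ((√(m i) : ℝ) : ℂ))]
  have h3 := Complex.HadamardThreeLines.norm_le_interp_of_mem_verticalClosedStrip₀₁' g (z := s)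
    (a := S) (b := T / p + (1 - 1 / p) * S) ⟨by simpa using hs0.le, by simpa using hs1⟩
    hgd.diffContOnCl hgb hg0 hg1
  rw [hgs, Complex.norm_real, Real.norm_of_nonneg hS0, Complex.ofReal_re] at h3
  by_contra! hlt
  have hpp : 0 < p := by linarith
  have hB : T / p + (1 - 1 / p) * S < S := by
    have : T / p < S / p := by gcongr
    have e : S / p + (1 - 1 / p) * S = S := by field_simp; ring
    linarith
  have hB0 : 0 ≤ T / p + (1 - 1 / p) * S := by
    have : 0 ≤ 1 - 1 / p := by rw [sub_nonneg, div_le_one hpp]; exact hp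
    positivity
  have h4 : S ^ (1 - s) * (T / p + (1 - 1 / p) * S) ^ s < S ^ (1 - s) * S ^ s := by
    gcongr
  rw [← Real.rpow_add hSpos, sub_add_cancel, Real.rpow_one] at h4
  exact absurd h3 (not_le.2 h4)

end ArakiLiebThirring

section MatrixPower

variable {n : Type*} [Fintype n] [DecidableEq n]

lemma mrpow_eq_of_isHermitian {A : Matrix n n ℂ} (h : A.IsHermitian) (r : ℝ) :
    mrpow A r = (h.eigenvectorUnitary : Matrix n n ℂ) *
      diagonal (fun i => ((h.eigenvalues i ^ r : ℝ) : ℂ)) *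
      (h.eigenvectorUnitary : Matrix n n ℂ)ᴴ := by
  rw [mrpow, dif_pos h, star_eq_conjTranspose]

lemma trace_mrpow {A : Matrix n n ℂ} (h : A.IsHermitian) (r : ℝ) :
    (mrpow A r).trace = ((∑ i, h.eigenvalues i ^ r : ℝ) : ℂ) := by
  rw [mrpow_eq_of_isHermitian h, trace_mul_cycle, ← star_eq_conjTranspose,
    mem_unitaryGroup_iff'.1 h.eigenvectorUnitary.2, one_mul, trace_diagonal]
  push_cast
  rfl

lemma eq_eigenvectorUnitary_mul_diagonal_mul {A : Matrix n n ℂ} (h : A.IsHermitian) :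
    A = (h.eigenvectorUnitary : Matrix n n ℂ) *
      diagonal (fun i => (h.eigenvalues i : ℂ)) * (h.eigenvectorUnitary : Matrix n n ℂ)ᴴ := by
  conv_lhs => rw [h.spectral_theorem, Unitary.conjStarAlgAut_apply]
  rfl

lemma conjM_posSemidef {A : Matrix n n ℂ} (hA : A.PosSemidef) : (conjM A).PosSemidef := by
  have h : conjM A = Aᵀ := by
    conv_rhs => rw [← hA.isHermitian.eq]
    rfl
  rw [h]
  exact hA.transpose

/-- The matrix in the definition of `fRenyi` is unitarily equivalent to `F(w) F(w)ᴴ`, where `F` is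
the `powSandwich` family for the eigenvalues of `σ` and `ρ`. -/
lemma mrpow_mul_mrpow_mul_mrpow_eq {ρ σ : Matrix n n ℂ} (hρ : ρ.PosSemidef) (hσ : σ.PosSemidef)
    {a b w : ℝ} (hw : w ≠ 0) :
    mrpow σ (a * w) * mrpow ρ (2 * b * w) * mrpow σ (a * w) =
      (hσ.isHermitian.eigenvectorUnitary : Matrix n n ℂ) *
        (powSandwich (fun i => hσ.isHermitian.eigenvalues i ^ a)
            (fun i => hρ.isHermitian.eigenvalues i ^ b)
            ((hσ.isHermitian.eigenvectorUnitary : Matrix n n ℂ)ᴴ *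
              (hρ.isHermitian.eigenvectorUnitary : Matrix n n ℂ)) w *
          (powSandwich (fun i => hσ.isHermitian.eigenvalues i ^ a)
            (fun i => hρ.isHermitian.eigenvalues i ^ b)
            ((hσ.isHermitian.eigenvectorUnitary : Matrix n n ℂ)ᴴ *
              (hρ.isHermitian.eigenvectorUnitary : Matrix n n ℂ)) w)ᴴ) *
        (hσ.isHermitian.eigenvectorUnitary : Matrix n n ℂ)ᴴ := by
  rw [mrpow_eq_of_isHermitian hσ.isHermitian, mrpow_eq_of_isHermitian hρ.isHermitian]
  have pow_eq : ∀ {x : ℝ} (_ : 0 ≤ x) (t : ℝ), entirePow (x ^ t) w = ((x ^ (t * w) : ℝ) : ℂ) :=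
    fun hx t => by rw [entirePow_ofReal (Real.rpow_nonneg hx t) hw, Real.rpow_mul hx]
  have adj : ∀ v : n → ℝ, (diagonal (fun i => (v i : ℂ)))ᴴ = diagonal (fun i => (v i : ℂ)) :=
    fun v => by
      rw [diagonal_conjTranspose]
      congr 1
      ext i
      simp
  have sq : diagonal (fun i => ((hρ.isHermitian.eigenvalues i ^ (2 * b * w) : ℝ) : ℂ)) =
      diagonal (fun i => ((hρ.isHermitian.eigenvalues i ^ (b * w) : ℝ) : ℂ)) *
        diagonal (fun i => ((hρ.isHermitian.eigenvalues i ^ (b * w) : ℝ) : ℂ)) := by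
    rw [diagonal_mul_diagonal]
    congr 1
    ext i
    rw [← Complex.ofReal_mul, ← pow_two, ← Real.rpow_mul_natCast (hρ.eigenvalues_nonneg i)]
    congr 2
    push_cast
    ring
  simp only [powSandwich, pow_eq (hσ.eigenvalues_nonneg _), pow_eq (hρ.eigenvalues_nonneg _),
    conjTranspose_mul, conjTranspose_conjTranspose, adj, sq]
  simp only [mul_assoc]

lemma eq_unitary_mul_diagonal_mul_of_eq {V G K : Matrix n n ℂ} (hV : V ∈ unitaryGroup n ℂ)
    (hK : K.IsHermitian) (h : K = V * G * Vᴴ) :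
    G = (Vᴴ * (hK.eigenvectorUnitary : Matrix n n ℂ)) *
      diagonal (fun i => (hK.eigenvalues i : ℂ)) *
      (Vᴴ * (hK.eigenvectorUnitary : Matrix n n ℂ))ᴴ := by
  have hV' : Vᴴ * V = 1 := mem_unitaryGroup_iff'.1 hV
  calc G = (Vᴴ * V) * G * (Vᴴ * V) := by rw [hV', one_mul, mul_one]
    _ = Vᴴ * K * V := by rw [h]; simp only [mul_assoc]
    _ = _ := by
      conv_lhs => rw [eq_eigenvectorUnitary_mul_diagonal_mul hK]
      simp only [conjTranspose_mul, conjTranspose_conjTranspose, mul_assoc]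

lemma trace_mrpow_le_of_powSandwich {c d : n → ℝ} (hc : ∀ i, 0 ≤ c i) (hd : ∀ i, 0 ≤ d i)
    {V W K L : Matrix n n ℂ} (hV : V ∈ unitaryGroup n ℂ) (hW : ‖W‖ ≤ 1)
    {s p : ℝ} (hs0 : 0 < s) (hs1 : s ≤ 1) (hp : 1 ≤ p)
    (hK : K = V * (powSandwich c d W s * (powSandwich c d W s)ᴴ) * Vᴴ)
    (hL : L = V * (powSandwich c d W 1 * (powSandwich c d W 1)ᴴ) * Vᴴ) :
    (mrpow K (p / (2 * s))).trace ≤ (mrpow L (p / 2)).trace := by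
  have hVs : Vᴴ ∈ unitaryGroup n ℂ := Unitary.star_mem hV
  have hKp : K.PosSemidef := by
    rw [hK]; exact (posSemidef_self_mul_conjTranspose _).mul_mul_conjTranspose_same V
  have hLp : L.PosSemidef := by
    rw [hL]; exact (posSemidef_self_mul_conjTranspose _).mul_mul_conjTranspose_same V
  rw [trace_mrpow hKp.isHermitian, trace_mrpow hLp.isHermitian]
  have key := sum_rpow_le_of_powSandwich hc hd hW
    (mul_mem hVs hKp.isHermitian.eigenvectorUnitary.2)
    (mul_mem hVs hLp.isHermitian.eigenvectorUnitary.2)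
    hKp.eigenvalues_nonneg hLp.eigenvalues_nonneg hs0 hs1 hp
    (eq_unitary_mul_diagonal_mul_of_eq hV hKp.isHermitian hK)
    (eq_unitary_mul_diagonal_mul_of_eq hV hLp.isHermitian hL)
  exact_mod_cast key

/-- The quantity `f_{α,z}(ρ, σ)` is antitone in `z ≥ 1/2`. -/
theorem fRenyi_antitone {ρ σ : Matrix n n ℂ} (hρ : ρ.PosSemidef) (hσ : σ.PosSemidef)
    (α : ℝ) {z₁ z₂ : ℝ} (hz : 1 / 2 ≤ z₁) (h12 : z₁ ≤ z₂) :
    fRenyi α z₂ ρ σ ≤ fRenyi α z₁ ρ σ := by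
  have hz₁ : 0 < z₁ := by linarith
  have hz₂ : 0 < z₂ := by linarith
  have hs : 0 < z₁ / z₂ := by positivity
  have h2 := mrpow_mul_mrpow_mul_mrpow_eq hρ hσ (a := (1 - α) / (2 * z₁)) (b := α / (2 * z₁)) hs.ne'
  have h1 := mrpow_mul_mrpow_mul_mrpow_eq hρ hσ (a := (1 - α) / (2 * z₁)) (b := α / (2 * z₁))
    one_ne_zero
  have e1 : (1 - α) / (2 * z₁) * (z₁ / z₂) = (1 - α) / (2 * z₂) := by field_simp
  have e2 : 2 * (α / (2 * z₁)) * (z₁ / z₂) = α / z₂ := by field_simp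
  have e3 : 2 * (α / (2 * z₁)) = α / z₁ := by field_simp
  have e4 : 2 * z₁ / (2 * (z₁ / z₂)) = z₂ := by field_simp
  have e5 : 2 * z₁ / 2 = z₁ := by ring
  rw [e1, e2] at h2
  rw [mul_one, mul_one, e3, Complex.ofReal_one] at h1
  have hV := hσ.isHermitian.eigenvectorUnitary.2
  have hW := norm_le_one_of_mem_unitaryGroup
    (mul_mem (Unitary.star_mem hV) hρ.isHermitian.eigenvectorUnitary.2)
  have key := trace_mrpow_le_of_powSandwich (p := 2 * z₁)
    (fun i => Real.rpow_nonneg (hσ.eigenvalues_nonneg i) _)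
    (fun i => Real.rpow_nonneg (hρ.eigenvalues_nonneg i) _)
    hV hW hs ((div_le_one hz₂).2 h12) (by linarith) h2 h1
  rwa [e4, e5] at key

end MatrixPower

theorem stmt11 {n : Type*} [Fintype n] [DecidableEq n] (ρ : Matrix n n ℂ)
    (hρ : ρ.PosSemidef) (htr : ρ.trace = 1)
    (α z₁ z₂ : ℝ) (h0 : 0 < max α (1 - α)) (hz : max α (1 - α) ≤ z₁)
    (h12 : z₁ ≤ z₂) (hz1 : z₂ < 1) :
    fRenyi α z₂ ρ (conjM ρ) ≤ fRenyi α z₁ ρ (conjM ρ) ∧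
      1 - fRenyi α z₁ ρ (conjM ρ) ≤ 1 - fRenyi α z₂ ρ (conjM ρ) := by
  have hz' : 1 / 2 ≤ z₁ := by linarith [(le_max_left α (1 - α)).trans hz,
    (le_max_right α (1 - α)).trans hz]
  have h := fRenyi_antitone hρ (conjM_posSemidef hρ) α hz' h12
  exact ⟨h, sub_le_sub_left h 1⟩
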